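/- Let ω ⊂ ℝ² be a bounded open set, let α ∈ {−1, 0, 1}, and let M > 0 and δ₀ > 0. Suppose that for every δ ∈ (0, δ₀) we are given maps y^δ : ℝ² → ℝ³, three times continuously differentiable on an open neighborhood of the closure of ω, and b^δ : ℝ² → ℝ³, twice continuously differentiable on an open neighborhood of the closure of ω, such that on ω: det(∇̃y^δ | b^δ) = 1, where (∇̃y^δ | b^δ) ∈ ℝ^{3×3} has first two columns ∂₁y^δ, ∂₂y^δ and third column b^δ; sup(|∇̃y^δ| + |b^δ|) ≤ M; sup(|∇̃∇̃y^δ| + |∇̃b^δ|) ≤ M δ^{min{−α, 0}}; and sup(|∇̃^{(3)}y^δ| + |∇̃∇̃b^δ|) ≤ M δ^{−α−1}. Then there exists m ≥ 1, depending only on M and α, such that, setting δ_h := mh, for all sufficiently small h > 0 there exists a unique function ξ^h : Ω̄_h → ℝ, continuously differentiable on Ω̄_h (Ω_h := ω × (−h/2, h/2)), with ξ^h(x̃, 0) = 0 for all x̃, for which the map Y^h := y^{δ_h} + ξ^h b^{δ_h} satisfies det ∇Y^h = 1 everywhere on Ω_h. Moreover, there exists C > 0, depending only on M and not on h, such that for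 all (x̃, x₃) ∈ Ω_h: |ξ^h(x̃, x₃) − x₃| ≤ C h^{min{−α,0}} x₃², |∂₃ξ^h(x̃, x₃) − 1| ≤ C h^{min{−α,0}} |x₃|, and |∇̃ξ^h(x̃, x₃)| ≤ C h^{−α−1} x₃². -/

import Mathlib

open Matrix MeasureTheory

noncomputable section

/-- Planar Jacobian `∇̃y = (∂₁y | ∂₂y) ∈ ℝ^{3×2}` of a map `y : ℝ² → ℝ³`. -/
def jac32 (y : (Fin 2 → ℝ) → Fin 3 → ℝ) (x : Fin 2 → ℝ) : Matrix (Fin 3) (Fin 2) ℝ :=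
  Matrix.of fun i j => fderiv ℝ y x (Pi.single j 1) i

/-- Full Jacobian `∇Y ∈ ℝ^{3×3}` of a map `Y : ℝ³ → ℝ³`. -/
def jac3 (Y : (Fin 3 → ℝ) → Fin 3 → ℝ) (x : Fin 3 → ℝ) : Matrix (Fin 3) (Fin 3) ℝ :=
  Matrix.of fun i j => fderiv ℝ Y x (Pi.single j 1) i

/-- The 3×3 matrix `(F̃ | b)` with first two columns those of `F̃` and third column `b`. -/
def aug (F : Matrix (Fin 3) (Fin 2) ℝ) (b : Fin 3 → ℝ) : Matrix (Fin 3) (Fin 3) ℝ :=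
  Matrix.of fun i j => if h : (j : ℕ) < 2 then F i ⟨j, h⟩ else b i

/-- Planar projection `(x₁, x₂)` of a point `x ∈ ℝ³`. -/
def proj2 (x : Fin 3 → ℝ) : Fin 2 → ℝ := fun j => x j.castSucc

/-- The point `(xt, c) ∈ ℝ³`. -/
def emb (xt : Fin 2 → ℝ) (c : ℝ) : Fin 3 → ℝ :=
  fun i => if h : (i : ℕ) < 2 then xt ⟨i, h⟩ else c

/-- The thin sheet `Ω_h = ω × (-h/2, h/2)`. -/
def slab (ω : Set (Fin 2 → ℝ)) (h : ℝ) : Set (Fin 3 → ℝ) :=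
  {x | proj2 x ∈ ω ∧ x 2 ∈ Set.Ioo (-(h / 2)) (h / 2)}

open Set Filter Topology

/-! ### The scalar equation `s + a s² / 2 + b s³ / 3 = t` -/

/-- The primitive `s + a s² / 2 + b s³ / 3` of `1 + a s + b s²` vanishing at `0`. -/
def cubicPrim (a b s : ℝ) : ℝ := s + a * s ^ 2 / 2 + b * s ^ 3 / 3

lemma abs_mul_add_mul_sq_le {a b h s : ℝ} (hs : |s| ≤ h) :
    |a * s + b * s ^ 2| ≤ |a| * h + |b| * h ^ 2 := by
  refine (abs_add_le _ _).trans ?_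
  rw [abs_mul, abs_mul, abs_pow]
  gcongr

lemma abs_cubicPrim_sub_le (a b s : ℝ) :
    |cubicPrim a b s - s| ≤ s ^ 2 * (|a| / 2 + |b| * |s| / 3) := by
  have : cubicPrim a b s - s = s ^ 2 * (a / 2 + b * s / 3) := by unfold cubicPrim; ring
  rw [this, abs_mul, abs_of_nonneg (sq_nonneg s)]
  gcongr
  refine (abs_add_le _ _).trans ?_
  simp [abs_mul, abs_div]

lemma le_abs_cubicPrim {a b h s : ℝ} (hab : |a| * h + |b| * h ^ 2 ≤ 1 / 2) (hs : |s| ≤ h) :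
    3 / 4 * |s| ≤ |cubicPrim a b s| := by
  have h1 := abs_cubicPrim_sub_le a b s
  have h2 : s ^ 2 * (|a| / 2 + |b| * |s| / 3) ≤ |s| * (1 / 4) := by
    have h3 : |a| * |s| ≤ |a| * h := by gcongr
    have h4 : |b| * |s| ^ 2 ≤ |b| * h ^ 2 := by gcongr
    have h5 : 0 ≤ |b| * |s| ^ 2 := by positivity
    calc s ^ 2 * (|a| / 2 + |b| * |s| / 3)
        = |s| * (|a| * |s| / 2 + |b| * |s| ^ 2 / 3) := by rw [← sq_abs]; ring
      _ ≤ |s| * (1 / 4) := by gcongr; linarith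
  have h3 := abs_sub_abs_le_abs_sub s (cubicPrim a b s)
  rw [abs_sub_comm] at h3
  linarith

lemma cubicPrim_injOn {a b h : ℝ} (hab : |a| * h + |b| * h ^ 2 ≤ 1 / 2) {s s' : ℝ}
    (hs : |s| ≤ h) (hs' : |s'| ≤ h) (heq : cubicPrim a b s = cubicPrim a b s') : s = s' := by
  have hfac : (s - s') * (1 + a * ((s + s') / 2) + b * ((s ^ 2 + s * s' + s' ^ 2) / 3)) = 0 := by
    unfold cubicPrim at heq
    linear_combination heq
  have h1 : |a * ((s + s') / 2)| ≤ |a| * h := by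
    rw [abs_mul]
    gcongr
    rw [abs_le] at *
    constructor <;> linarith
  have h2 : |b * ((s ^ 2 + s * s' + s' ^ 2) / 3)| ≤ |b| * h ^ 2 := by
    have h3 : s ^ 2 ≤ h ^ 2 := sq_le_sq' (neg_le_of_abs_le hs) (le_of_abs_le hs)
    have h4 : s' ^ 2 ≤ h ^ 2 := sq_le_sq' (neg_le_of_abs_le hs') (le_of_abs_le hs')
    rw [abs_mul]
    gcongr
    rw [abs_le]
    constructor <;> nlinarith [sq_nonneg (s + s'), sq_nonneg (s - s')]
  rcases mul_eq_zero.1 hfac with h3 | h3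
  · linarith
  · rw [abs_le] at h1 h2
    linarith

lemma exists_cubicPrim_eq {a b h t : ℝ} (hab : |a| * h + |b| * h ^ 2 ≤ 1 / 2)
    (ht : |t| ≤ h / 2) : ∃ s, |s| ≤ h ∧ cubicPrim a b s = t := by
  have hh : 0 ≤ h := by linarith [abs_nonneg t]
  have hc : ContinuousOn (cubicPrim a b) (Icc (-h) h) := by
    unfold cubicPrim; fun_prop
  have h1 : |cubicPrim a b h - h| ≤ h / 4 ∧ |cubicPrim a b (-h) - (-h)| ≤ h / 4 := by
    have h2 := abs_cubicPrim_sub_le a b h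
    have h3 := abs_cubicPrim_sub_le a b (-h)
    rw [abs_neg, neg_sq] at h3
    have h4 : h ^ 2 * (|a| / 2 + |b| * |h| / 3) ≤ h / 4 := by
      rw [abs_of_nonneg hh]
      have h5 : 0 ≤ |b| * h ^ 2 := by positivity
      calc _ = h * (|a| * h / 2 + |b| * h ^ 2 / 3) := by ring
        _ ≤ h * (1 / 4) := by gcongr; linarith
        _ = _ := by ring
    exact ⟨h2.trans h4, h3.trans h4⟩
  simp only [abs_le] at h1 ht
  obtain ⟨s, hs, hst⟩ := intermediate_value_Icc (by linarith) hc
    (show t ∈ Icc (cubicPrim a b (-h)) (cubicPrim a b h) by constructor <;> linarith)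
  exact ⟨s, abs_le.2 hs, hst⟩

lemma HasDerivAt.cubicPrim {a b g : ℝ → ℝ} {a' b' g' t : ℝ} (ha : HasDerivAt a a' t)
    (hb : HasDerivAt b b' t) (hg : HasDerivAt g g' t) :
    HasDerivAt (fun r => cubicPrim (a r) (b r) (g r))
      (g' * (1 + a t * g t + b t * g t ^ 2) + (a' * g t ^ 2 / 2 + b' * g t ^ 3 / 3)) t := by
  unfold _root_.cubicPrim
  refine ((hg.add ((ha.mul (hg.pow 2)).div_const 2)).add
    ((hb.mul (hg.pow 3)).div_const 3)).congr_deriv ?_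
  simp
  ring

/-- A solution of the differential equation `g' = 1 / (1 + a g + b g²)` with `g 0 = 0` stays in
`[-h, h]` and solves the scalar equation. -/
lemma cubicPrim_eq_of_hasDerivAt {a b h : ℝ} (hh : 0 < h)
    (hab : |a| * h + |b| * h ^ 2 ≤ 1 / 2) {g g' : ℝ → ℝ} (hg0 : g 0 = 0)
    (hg : ∀ t ∈ Ioo (-(h / 2)) (h / 2), HasDerivAt g (g' t) t)
    (hode : ∀ t ∈ Ioo (-(h / 2)) (h / 2), g' t * (1 + a * g t + b * g t ^ 2) = 1)
    {t : ℝ} (ht : t ∈ Ioo (-(h / 2)) (h / 2)) : |g t| ≤ h ∧ cubicPrim a b (g t) = t := by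
  have h0 : (0 : ℝ) ∈ Ioo (-(h / 2)) (h / 2) := ⟨by linarith, by linarith⟩
  have hsol : ∀ r ∈ Ioo (-(h / 2)) (h / 2), cubicPrim a b (g r) = r := by
    intro r hr
    have hd : ∀ r ∈ Ioo (-(h / 2)) (h / 2),
        HasDerivAt (fun r => cubicPrim a b (g r) - r) 0 r := by
      intro r hr
      refine (((hasDerivAt_const r a).cubicPrim (hasDerivAt_const r b) (hg r hr)).sub
        (hasDerivAt_id r)).congr_deriv ?_
      rw [hode r hr]
      ring
    have := isOpen_Ioo.is_const_of_deriv_eq_zero isPreconnected_Ioo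
      (fun r hr => (hd r hr).differentiableAt.differentiableWithinAt)
      (fun r hr => (hd r hr).deriv) hr h0
    simp only [hg0] at this
    simp only [cubicPrim] at this ⊢
    linarith
  refine ⟨?_, hsol t ht⟩
  by_contra! hlt
  have hsub : uIcc 0 t ⊆ Ioo (-(h / 2)) (h / 2) := ordConnected_Ioo.uIcc_subset h0 ht
  have hc : ContinuousOn (fun r => |g r|) (uIcc 0 t) :=
    ContinuousOn.abs fun r hr => (hg r (hsub hr)).continuousAt.continuousWithinAt
  obtain ⟨r, hr, hrh⟩ := intermediate_value_uIcc hc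
    (show h ∈ uIcc (|g 0|) (|g t|) by
      rw [hg0, abs_zero, uIcc_of_le (abs_nonneg _)]; exact ⟨hh.le, hlt.le⟩)
  have h1 := le_abs_cubicPrim hab (le_of_eq hrh)
  simp only at hrh
  have h2 := abs_lt.2 (hsub hr)
  rw [hsol r (hsub hr), hrh] at h1
  linarith

/-! ### Coordinates on the slab -/

@[simp] lemma proj2_emb (x : Fin 2 → ℝ) (t : ℝ) : proj2 (emb x t) = x := by
  ext j; fin_cases j <;> simp [proj2, emb]

@[simp] lemma emb_two (x : Fin 2 → ℝ) (t : ℝ) : emb x t 2 = t := by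
  simp [emb]

lemma emb_proj2 (z : Fin 3 → ℝ) : emb (proj2 z) (z 2) = z := by
  ext j; fin_cases j <;> simp [proj2, emb]

lemma emb_eq_add_smul (x : Fin 2 → ℝ) (t : ℝ) :
    emb x t = emb x 0 + t • Pi.single 2 1 := by
  ext j; fin_cases j <;> simp [emb]

lemma proj2_single_zero : proj2 (Pi.single 0 1) = Pi.single 0 1 := by
  ext j; fin_cases j <;> simp [proj2]

lemma proj2_single_one : proj2 (Pi.single 1 1) = Pi.single 1 1 := by
  ext j; fin_cases j <;> simp [proj2]

lemma proj2_single_two : proj2 (Pi.single 2 1) = 0 := by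
  ext j; fin_cases j <;> simp [proj2]

/-- The planar projection as a continuous linear map. -/
def proj2L : (Fin 3 → ℝ) →L[ℝ] Fin 2 → ℝ :=
  ContinuousLinearMap.pi fun j => ContinuousLinearMap.proj j.castSucc

lemma coe_proj2L : ⇑proj2L = proj2 := rfl

lemma continuous_proj2 : Continuous proj2 := proj2L.continuous

lemma hasFDerivAt_proj2 (z : Fin 3 → ℝ) : HasFDerivAt proj2 proj2L z := proj2L.hasFDerivAt

lemma contDiff_proj2 {n : WithTop ℕ∞} : ContDiff ℝ n proj2 := proj2L.contDiff

lemma isOpen_slab {ω : Set (Fin 2 → ℝ)} (hω : IsOpen ω) (h : ℝ) : IsOpen (slab ω h) :=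
  (hω.preimage continuous_proj2).inter (isOpen_Ioo.preimage (continuous_apply 2))

lemma closure_slab_subset (ω : Set (Fin 2 → ℝ)) (h : ℝ) :
    closure (slab ω h) ⊆ {z | proj2 z ∈ closure ω ∧ |z 2| ≤ h / 2} := by
  refine closure_minimal (fun z hz => ⟨subset_closure hz.1, (abs_lt.2 hz.2).le⟩) ?_
  exact (isClosed_closure.preimage continuous_proj2).inter
    (isClosed_le (continuous_apply 2).abs continuous_const)

/-! ### The solution on the slab -/

section Solution

variable {ω U : Set (Fin 2 → ℝ)} {p q : (Fin 2 → ℝ) → ℝ} {h : ℝ}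

lemma HasFDerivAt.hasLineDerivAt_cubicPrim {ξ : (Fin 3 → ℝ) → ℝ} {z : Fin 3 → ℝ}
    {ξ' : (Fin 3 → ℝ) →L[ℝ] ℝ} {p' q' : (Fin 2 → ℝ) →L[ℝ] ℝ} (hξ : HasFDerivAt ξ ξ' z)
    (hp : HasFDerivAt p p' (proj2 z)) (hq : HasFDerivAt q q' (proj2 z)) (v : Fin 3 → ℝ) :
    HasLineDerivAt ℝ (fun z => cubicPrim (p (proj2 z)) (q (proj2 z)) (ξ z))
      (ξ' v * (1 + p (proj2 z) * ξ z + q (proj2 z) * ξ z ^ 2)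
        + (p' (proj2 v) * ξ z ^ 2 / 2 + q' (proj2 v) * ξ z ^ 3 / 3)) z v := by
  have h1 := (hp.comp z (hasFDerivAt_proj2 z)).hasLineDerivAt v
  have h2 := (hq.comp z (hasFDerivAt_proj2 z)).hasLineDerivAt v
  have h3 := hξ.hasLineDerivAt v
  unfold HasLineDerivAt at *
  refine (h1.cubicPrim h2 h3).congr_deriv ?_
  simp [coe_proj2L]

/-- The solution of the scalar equation with parameters is `C¹` where it is defined. -/
lemma contDiffOn_of_cubicPrim_eq (hU : IsOpen U) (hωU : closure ω ⊆ U)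
    (hp : ContDiffOn ℝ 1 p U) (hq : ContDiffOn ℝ 1 q U) (hh : 0 < h)
    (hpq : ∀ x ∈ closure ω, |p x| * h + |q x| * h ^ 2 ≤ 1 / 2) {ξ : (Fin 3 → ℝ) → ℝ}
    (hξ : ∀ z ∈ closure (slab ω h), |ξ z| ≤ h ∧
      cubicPrim (p (proj2 z)) (q (proj2 z)) (ξ z) = z 2) :
    ContDiffOn ℝ 1 ξ (closure (slab ω h)) := by
  intro z₀ hz₀
  obtain ⟨hzω, hzh⟩ := closure_slab_subset ω h hz₀
  obtain ⟨hs, hst⟩ := hξ z₀ hz₀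
  set s₀ := ξ z₀
  have hpq₀ := hpq _ hzω
  have hs_lt : |s₀| < h := by
    have := le_abs_cubicPrim hpq₀ hs
    rw [hst] at this
    linarith
  let f : (Fin 3 → ℝ) × ℝ → ℝ := fun w =>
    cubicPrim (p (proj2 w.1)) (q (proj2 w.1)) w.2 - w.1 2
  have hf0 : f (z₀, s₀) = 0 := sub_eq_zero.2 hst
  have hUz : U ∈ 𝓝 (proj2 z₀) := hU.mem_nhds (hωU hzω)
  have hf : ContDiffAt ℝ 1 f (z₀, s₀) := by
    have hfst : ContDiffAt ℝ 1 (fun w : (Fin 3 → ℝ) × ℝ => proj2 w.1) (z₀, s₀) :=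
      contDiff_proj2.contDiffAt.comp _ contDiffAt_fst
    have h1 : ContDiffAt ℝ 1 (fun w : (Fin 3 → ℝ) × ℝ => p (proj2 w.1)) (z₀, s₀) :=
      (hp.contDiffAt hUz).comp (z₀, s₀) hfst
    have h2 : ContDiffAt ℝ 1 (fun w : (Fin 3 → ℝ) × ℝ => q (proj2 w.1)) (z₀, s₀) :=
      (hq.contDiffAt hUz).comp (z₀, s₀) hfst
    simp only [f, cubicPrim]
    fun_prop
  have hderiv : fderiv ℝ f (z₀, s₀) (0, 1)
      = 1 + p (proj2 z₀) * s₀ + q (proj2 z₀) * s₀ ^ 2 := by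
    have h1 := (hf.differentiableAt one_ne_zero).hasFDerivAt.hasLineDerivAt (0, 1)
    have h2 := (((hasDerivAt_const (0 : ℝ) (p (proj2 z₀))).cubicPrim
      (hasDerivAt_const 0 (q (proj2 z₀)))
      ((hasDerivAt_id (0 : ℝ)).const_add s₀)).sub_const (z₀ 2))
    unfold HasLineDerivAt at h1
    refine h1.unique ((h2.congr_deriv ?_).congr_of_eventuallyEq (.of_forall fun r => ?_))
    · simp
    · simp [f]
  have hne : fderiv ℝ f (z₀, s₀) (0, 1) ≠ 0 := by
    rw [hderiv]
    have h1 := (abs_mul_add_mul_sq_le (a := p (proj2 z₀)) (b := q (proj2 z₀)) hs).trans hpq₀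
    rw [abs_le] at h1
    linarith
  have hinv : (fderiv ℝ f (z₀, s₀) ∘L .inr ℝ (Fin 3 → ℝ) ℝ).IsInvertible := by
    refine ⟨ContinuousLinearEquiv.unitsEquivAut ℝ (Units.mk0 _ hne), ?_⟩
    ext
    simp
  have hsol := hf.eventually_apply_implicitFunction one_ne_zero hinv
  have hψ := hf.contDiffAt_implicitFunction one_ne_zero hinv
  have hψ0 := hf.implicitFunction_apply_self one_ne_zero hinv
  set ψ := hf.implicitFunction one_ne_zero hinv
  simp only at hsol hψ hψ0
  have hsmall : ∀ᶠ z in 𝓝 z₀, |ψ z| < h :=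
    hψ.continuousAt.abs.eventually_lt_const (by simpa [hψ0] using hs_lt)
  refine hψ.contDiffWithinAt.congr_of_eventuallyEq ?_ hψ0.symm
  filter_upwards [nhdsWithin_le_nhds hsol, nhdsWithin_le_nhds hsmall, self_mem_nhdsWithin]
    with z hz1 hz2 hz3
  have hzω' := (closure_slab_subset ω h hz3).1
  refine cubicPrim_injOn (hpq _ hzω') (hξ z hz3).1 hz2.le ?_
  rw [(hξ z hz3).2]
  rw [hf0] at hz1
  exact (sub_eq_zero.1 hz1).symm

lemma exists_cubicPrim_eq_on_slab
    (hpq : ∀ x ∈ closure ω, |p x| * h + |q x| * h ^ 2 ≤ 1 / 2) :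
    ∃ ξ : (Fin 3 → ℝ) → ℝ, ∀ z, proj2 z ∈ closure ω → |z 2| ≤ h / 2 →
      |ξ z| ≤ h ∧ cubicPrim (p (proj2 z)) (q (proj2 z)) (ξ z) = z 2 := by
  choose! ξ hξ using fun (z : Fin 3 → ℝ) (hz : proj2 z ∈ closure ω ∧ |z 2| ≤ h / 2) =>
    exists_cubicPrim_eq (hpq _ hz.1) hz.2
  exact ⟨ξ, fun z h1 h2 => hξ z ⟨h1, h2⟩⟩

lemma cubicPrim_eq_of_fderiv (hω : IsOpen ω) (hh : 0 < h)
    (hpq : ∀ x ∈ ω, |p x| * h + |q x| * h ^ 2 ≤ 1 / 2) {ξ : (Fin 3 → ℝ) → ℝ}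
    (hξ : DifferentiableOn ℝ ξ (slab ω h)) (hξ0 : ∀ x ∈ ω, ξ (emb x 0) = 0)
    (hode : ∀ z ∈ slab ω h, fderiv ℝ ξ z (Pi.single 2 1) *
      (1 + p (proj2 z) * ξ z + q (proj2 z) * ξ z ^ 2) = 1)
    {z : Fin 3 → ℝ} (hz : z ∈ slab ω h) :
    |ξ z| ≤ h ∧ cubicPrim (p (proj2 z)) (q (proj2 z)) (ξ z) = z 2 := by
  have hmem : ∀ t ∈ Ioo (-(h / 2)) (h / 2), emb (proj2 z) t ∈ slab ω h := fun t ht => by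
    simpa [slab] using ⟨hz.1, ht⟩
  have key := cubicPrim_eq_of_hasDerivAt (g := fun t => ξ (emb (proj2 z) t))
    (g' := fun t => fderiv ℝ ξ (emb (proj2 z) t) (Pi.single 2 1)) hh (hpq _ hz.1)
    (hξ0 _ hz.1) ?_ ?_ hz.2
  · simpa only [emb_proj2] using key
  · intro t ht
    have hd := (hξ.differentiableAt ((isOpen_slab hω h).mem_nhds (hmem t ht))).hasFDerivAt
    refine hd.comp_hasDerivAt t ?_
    have : emb (proj2 z) = fun t => emb (proj2 z) 0 + t • Pi.single 2 1 :=
      funext (emb_eq_add_smul _)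
    rw [this]
    simpa using ((hasDerivAt_id t).smul_const (Pi.single 2 1 : Fin 3 → ℝ)).const_add
      (emb (proj2 z) 0)
  · intro t ht
    simpa using hode _ (hmem t ht)

/-- Differentiating the scalar equation in the direction `v`. -/
lemma fderiv_of_cubicPrim_eq (hω : IsOpen ω) {ξ : (Fin 3 → ℝ) → ℝ}
    (hξ : ∀ z ∈ slab ω h, cubicPrim (p (proj2 z)) (q (proj2 z)) (ξ z) = z 2)
    {z : Fin 3 → ℝ} (hz : z ∈ slab ω h) (hd : DifferentiableAt ℝ ξ z)
    (hp : DifferentiableAt ℝ p (proj2 z)) (hq : DifferentiableAt ℝ q (proj2 z))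
    (v : Fin 3 → ℝ) :
    fderiv ℝ ξ z v * (1 + p (proj2 z) * ξ z + q (proj2 z) * ξ z ^ 2)
      + (fderiv ℝ p (proj2 z) (proj2 v) * ξ z ^ 2 / 2
        + fderiv ℝ q (proj2 z) (proj2 v) * ξ z ^ 3 / 3) = v 2 := by
  have h1 := hd.hasFDerivAt.hasLineDerivAt_cubicPrim hp.hasFDerivAt hq.hasFDerivAt v
  have h2 : HasLineDerivAt ℝ (fun z : Fin 3 → ℝ => z 2) (v 2) z v :=
    (hasFDerivAt_apply (𝕜 := ℝ) (2 : Fin 3) z).hasLineDerivAt v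
  have h3 : (fun z => cubicPrim (p (proj2 z)) (q (proj2 z)) (ξ z)) =ᶠ[𝓝 z] fun z => z 2 := by
    filter_upwards [(isOpen_slab hω h).mem_nhds hz] with w hw using hξ w hw
  exact (h1.congr_of_eventuallyEq h3.symm).unique h2

end Solution

/-! ### The Jacobian determinant as a polynomial in `ξ` -/

/-- The determinant of the matrix with columns `u`, `v`, `w`. -/
def tripleProd (u v w : Fin 3 → ℝ) : ℝ :=
  u 0 * (v 1 * w 2 - v 2 * w 1) - u 1 * (v 0 * w 2 - v 2 * w 0) + u 2 * (v 0 * w 1 - v 1 * w 0)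

lemma abs_tripleProd_le {u v w : Fin 3 → ℝ} {a b c : ℝ} (hu : ‖u‖ ≤ a) (hv : ‖v‖ ≤ b)
    (hw : ‖w‖ ≤ c) : |tripleProd u v w| ≤ 6 * a * b * c := by
  have h1 : ∀ i j k, |u i * (v j * w k)| ≤ a * (b * c) := by
    intro i j k
    have hui := (norm_le_pi_norm u i).trans hu
    have hvj := (norm_le_pi_norm v j).trans hv
    have hwk := (norm_le_pi_norm w k).trans hw
    rw [Real.norm_eq_abs] at hui hvj hwk
    have hb := (abs_nonneg _).trans hvj
    have ha := (abs_nonneg _).trans hui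
    rw [abs_mul, abs_mul]
    gcongr
  have h2 : tripleProd u v w = u 0 * (v 1 * w 2) - u 0 * (v 2 * w 1) - u 1 * (v 0 * w 2)
      + u 1 * (v 2 * w 0) + u 2 * (v 0 * w 1) - u 2 * (v 1 * w 0) := by
    unfold tripleProd; ring
  have h012 := abs_le.1 (h1 0 1 2)
  have h021 := abs_le.1 (h1 0 2 1)
  have h102 := abs_le.1 (h1 1 0 2)
  have h120 := abs_le.1 (h1 1 2 0)
  have h201 := abs_le.1 (h1 2 0 1)
  have h210 := abs_le.1 (h1 2 1 0)
  rw [h2, abs_le]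
  constructor <;> linarith

lemma HasDerivAt.tripleProd {u v w : ℝ → Fin 3 → ℝ} {u' v' w' : Fin 3 → ℝ} {t : ℝ}
    (hu : HasDerivAt u u' t) (hv : HasDerivAt v v' t) (hw : HasDerivAt w w' t) :
    HasDerivAt (fun t => tripleProd (u t) (v t) (w t))
      (tripleProd u' (v t) (w t) + tripleProd (u t) v' (w t) + tripleProd (u t) (v t) w') t := by
  rw [hasDerivAt_pi] at hu hv hw
  unfold _root_.tripleProd
  refine ((((hu 0).mul (((hv 1).mul (hw 2)).sub ((hv 2).mul (hw 1)))).sub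
    ((hu 1).mul (((hv 0).mul (hw 2)).sub ((hv 2).mul (hw 0))))).add
    ((hu 2).mul (((hv 0).mul (hw 1)).sub ((hv 1).mul (hw 0))))).congr_deriv ?_
  simp
  ring

lemma ContDiffOn.tripleProd {E : Type*} [NormedAddCommGroup E] [NormedSpace ℝ E]
    {u v w : E → Fin 3 → ℝ} {s : Set E} {n : WithTop ℕ∞} (hu : ContDiffOn ℝ n u s)
    (hv : ContDiffOn ℝ n v s) (hw : ContDiffOn ℝ n w s) :
    ContDiffOn ℝ n (fun x => tripleProd (u x) (v x) (w x)) s := by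
  rw [contDiffOn_pi] at hu hv hw
  have hu0 := hu 0
  have hu1 := hu 1
  have hu2 := hu 2
  have hv0 := hv 0
  have hv1 := hv 1
  have hv2 := hv 2
  have hw0 := hw 0
  have hw1 := hw 1
  have hw2 := hw 2
  unfold _root_.tripleProd
  fun_prop

/-- The coefficient of `s` in `det(∇̃y + s ∇̃b | b)`. -/
def linCoeff (y b : (Fin 2 → ℝ) → Fin 3 → ℝ) (x : Fin 2 → ℝ) : ℝ :=
  tripleProd (fderiv ℝ b x (Pi.single 0 1)) (fderiv ℝ y x (Pi.single 1 1)) (b x)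
    + tripleProd (fderiv ℝ y x (Pi.single 0 1)) (fderiv ℝ b x (Pi.single 1 1)) (b x)

/-- The coefficient of `s²` in `det(∇̃y + s ∇̃b | b)`. -/
def quadCoeff (b : (Fin 2 → ℝ) → Fin 3 → ℝ) (x : Fin 2 → ℝ) : ℝ :=
  tripleProd (fderiv ℝ b x (Pi.single 0 1)) (fderiv ℝ b x (Pi.single 1 1)) (b x)

section Coefficients

variable {y b : (Fin 2 → ℝ) → Fin 3 → ℝ} {U : Set (Fin 2 → ℝ)}

lemma det_jac3_eq {ξ : (Fin 3 → ℝ) → ℝ} {z : Fin 3 → ℝ}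
    (hy : DifferentiableAt ℝ y (proj2 z)) (hb : DifferentiableAt ℝ b (proj2 z))
    (hξ : DifferentiableAt ℝ ξ z) (hdet : (aug (jac32 y (proj2 z)) (b (proj2 z))).det = 1) :
    (jac3 (fun z => y (proj2 z) + ξ z • b (proj2 z)) z).det =
      fderiv ℝ ξ z (Pi.single 2 1) *
        (1 + linCoeff y b (proj2 z) * ξ z + quadCoeff b (proj2 z) * ξ z ^ 2) := by
  have hfd := (hy.hasFDerivAt.comp z (hasFDerivAt_proj2 z)).add
    (hξ.hasFDerivAt.smul (hb.hasFDerivAt.comp z (hasFDerivAt_proj2 z)))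
  have hjac : ∀ i j, jac3 (fun z => y (proj2 z) + ξ z • b (proj2 z)) z i j =
      fderiv ℝ y (proj2 z) (proj2 (Pi.single j 1)) i
      + (ξ z * fderiv ℝ b (proj2 z) (proj2 (Pi.single j 1)) i
        + fderiv ℝ ξ z (Pi.single j 1) * b (proj2 z) i) := by
    intro i j
    change fderiv ℝ ((y ∘ proj2) + ξ • (b ∘ proj2)) z (Pi.single j 1) i = _
    rw [hfd.fderiv]
    simp [coe_proj2L]
  rw [Matrix.det_fin_three] at hdet ⊢
  simp only [hjac, proj2_single_zero, proj2_single_one, proj2_single_two, map_zero, Pi.zero_apply]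
  simp [aug, jac32] at hdet
  unfold linCoeff quadCoeff tripleProd
  linear_combination fderiv ℝ ξ z (Pi.single 2 1) * hdet

lemma contDiffOn_fderiv_apply {n m : WithTop ℕ∞} (hU : IsOpen U) (hy : ContDiffOn ℝ n y U)
    (hmn : m + 1 ≤ n) (v : Fin 2 → ℝ) : ContDiffOn ℝ m (fun x => fderiv ℝ y x v) U :=
  (hy.fderiv_of_isOpen hU hmn).clm_apply contDiffOn_const

lemma contDiffOn_quadCoeff (hU : IsOpen U) (hb : ContDiffOn ℝ 2 b U) :
    ContDiffOn ℝ 1 (quadCoeff b) U := by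
  have h12 : (1 + 1 : WithTop ℕ∞) ≤ 2 := by norm_num
  exact (contDiffOn_fderiv_apply hU hb h12 _).tripleProd
    (contDiffOn_fderiv_apply hU hb h12 _) (hb.of_le one_le_two)

lemma contDiffOn_linCoeff (hU : IsOpen U) (hy : ContDiffOn ℝ 2 y U)
    (hb : ContDiffOn ℝ 2 b U) : ContDiffOn ℝ 1 (linCoeff y b) U := by
  have h12 : (1 + 1 : WithTop ℕ∞) ≤ 2 := by norm_num
  have hy' := fun v => contDiffOn_fderiv_apply hU hy h12 v
  have hb' := fun v => contDiffOn_fderiv_apply hU hb h12 v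
  have hb1 := hb.of_le one_le_two
  exact ((hb' _).tripleProd (hy' _) hb1).add ((hy' _).tripleProd (hb' _) hb1)

lemma norm_fderiv_single_le {E : Type*} [NormedAddCommGroup E] [NormedSpace ℝ E]
    (L : (Fin 2 → ℝ) →L[ℝ] E) (i : Fin 2) {M : ℝ} (hL : ‖L‖ ≤ M) :
    ‖L (Pi.single i 1)‖ ≤ M := by
  have h1 : ‖(Pi.single i 1 : Fin 2 → ℝ)‖ = 1 := by simp [Pi.norm_single]
  simpa [h1] using L.le_of_opNorm_le hL (Pi.single i 1)

lemma hasLineDerivAt_fderiv_apply {x : Fin 2 → ℝ} (hU : IsOpen U) (hy : ContDiffOn ℝ 2 y U)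
    (hx : x ∈ U) (v e : Fin 2 → ℝ) :
    HasLineDerivAt ℝ (fun x => fderiv ℝ y x v) (fderiv ℝ (fderiv ℝ y) x e v) x e := by
  have h12 : (1 + 1 : WithTop ℕ∞) ≤ 2 := by norm_num
  have hd : DifferentiableAt ℝ (fderiv ℝ y) x :=
    ((hy.fderiv_of_isOpen hU h12).contDiffAt (hU.mem_nhds hx)).differentiableAt one_ne_zero
  have := hd.hasFDerivAt.hasLineDerivAt e
  unfold HasLineDerivAt at *
  refine (this.clm_apply (hasDerivAt_const 0 v)).congr_deriv ?_
  simp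

variable {x : Fin 2 → ℝ} {M D₂ D₃ : ℝ}

lemma norm_fderiv_fderiv_le (hy : ‖iteratedFDeriv ℝ 2 y x‖ ≤ M) (i j : Fin 2) :
    ‖fderiv ℝ (fderiv ℝ y) x (Pi.single i 1) (Pi.single j 1)‖ ≤ M := by
  refine norm_fderiv_single_le _ j (norm_fderiv_single_le _ i ?_)
  rwa [← norm_iteratedFDeriv_one, norm_iteratedFDeriv_fderiv]

lemma abs_linCoeff_le (hy : ‖fderiv ℝ y x‖ ≤ M) (hb : ‖b x‖ ≤ M)
    (hb' : ‖fderiv ℝ b x‖ ≤ D₂) : |linCoeff y b x| ≤ 12 * M ^ 2 * D₂ := by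
  have h1 := abs_tripleProd_le (norm_fderiv_single_le _ 0 hb') (norm_fderiv_single_le _ 1 hy) hb
  have h2 := abs_tripleProd_le (norm_fderiv_single_le _ 0 hy) (norm_fderiv_single_le _ 1 hb') hb
  refine (abs_add_le _ _).trans ?_
  linarith

lemma abs_quadCoeff_le (hb : ‖b x‖ ≤ M) (hb' : ‖fderiv ℝ b x‖ ≤ D₂) :
    |quadCoeff b x| ≤ 6 * M * D₂ ^ 2 := by
  have h1 := abs_tripleProd_le (norm_fderiv_single_le _ 0 hb') (norm_fderiv_single_le _ 1 hb') hb
  unfold quadCoeff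
  linarith

lemma abs_fderiv_quadCoeff_le (hU : IsOpen U) (hbU : ContDiffOn ℝ 2 b U) (hx : x ∈ U)
    (hb : ‖b x‖ ≤ M) (hb' : ‖fderiv ℝ b x‖ ≤ D₂) (hb'' : ‖iteratedFDeriv ℝ 2 b x‖ ≤ D₃)
    (j : Fin 2) :
    |fderiv ℝ (quadCoeff b) x (Pi.single j 1)| ≤ 12 * M * D₂ * D₃ + 6 * D₂ ^ 3 := by
  have hB := fun i => hasLineDerivAt_fderiv_apply hU hbU hx (Pi.single i 1) (Pi.single j 1)
  have hb0 := ((hbU.contDiffAt (hU.mem_nhds hx)).differentiableAt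
    two_ne_zero).hasFDerivAt.hasLineDerivAt (Pi.single j 1)
  have hq := (((contDiffOn_quadCoeff hU hbU).contDiffAt (hU.mem_nhds hx)).differentiableAt
    one_ne_zero).hasFDerivAt.hasLineDerivAt (Pi.single j 1)
  unfold HasLineDerivAt at hB hb0 hq
  rw [hq.unique ((hB 0).tripleProd (hB 1) hb0)]
  simp only [zero_smul, add_zero]
  have n0 := norm_fderiv_single_le _ 0 hb'
  have n1 := norm_fderiv_single_le _ 1 hb'
  have h1 := abs_tripleProd_le (norm_fderiv_fderiv_le hb'' j 0) n1 hb
  have h2 := abs_tripleProd_le n0 (norm_fderiv_fderiv_le hb'' j 1) hb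
  have h3 := abs_tripleProd_le n0 n1 (norm_fderiv_single_le _ j hb')
  refine (abs_add_three _ _ _).trans ?_
  linarith

lemma abs_fderiv_linCoeff_le (hU : IsOpen U) (hyU : ContDiffOn ℝ 2 y U)
    (hbU : ContDiffOn ℝ 2 b U) (hx : x ∈ U) (hy' : ‖fderiv ℝ y x‖ ≤ M)
    (hy'' : ‖iteratedFDeriv ℝ 2 y x‖ ≤ D₂)
    (hb : ‖b x‖ ≤ M) (hb' : ‖fderiv ℝ b x‖ ≤ D₂) (hb'' : ‖iteratedFDeriv ℝ 2 b x‖ ≤ D₃)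
    (j : Fin 2) :
    |fderiv ℝ (linCoeff y b) x (Pi.single j 1)| ≤ 12 * M ^ 2 * D₃ + 24 * M * D₂ ^ 2 := by
  have hB := fun i => hasLineDerivAt_fderiv_apply hU hbU hx (Pi.single i 1) (Pi.single j 1)
  have hY := fun i => hasLineDerivAt_fderiv_apply hU hyU hx (Pi.single i 1) (Pi.single j 1)
  have hb0 := ((hbU.contDiffAt (hU.mem_nhds hx)).differentiableAt
    two_ne_zero).hasFDerivAt.hasLineDerivAt (Pi.single j 1)
  have hq := (((contDiffOn_linCoeff hU hyU hbU).contDiffAt (hU.mem_nhds hx)).differentiableAt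
    one_ne_zero).hasFDerivAt.hasLineDerivAt (Pi.single j 1)
  unfold HasLineDerivAt at hB hY hb0 hq
  rw [hq.unique (((hB 0).tripleProd (hY 1) hb0).add ((hY 0).tripleProd (hB 1) hb0))]
  simp only [zero_smul, add_zero]
  have nb := fun i => norm_fderiv_single_le _ i hb'
  have ny := fun i => norm_fderiv_single_le _ i hy'
  have h1 := abs_tripleProd_le (norm_fderiv_fderiv_le hb'' j 0) (ny 1) hb
  have h2 := abs_tripleProd_le (nb 0) (norm_fderiv_fderiv_le hy'' j 1) hb
  have h3 := abs_tripleProd_le (nb 0) (ny 1) (nb j)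
  have h4 := abs_tripleProd_le (norm_fderiv_fderiv_le hy'' j 0) (nb 1) hb
  have h5 := abs_tripleProd_le (ny 0) (norm_fderiv_fderiv_le hb'' j 1) hb
  have h6 := abs_tripleProd_le (ny 0) (nb 1) (nb j)
  refine (abs_add_le _ _).trans
    ((add_le_add (abs_add_three _ _ _) (abs_add_three _ _ _)).trans ?_)
  linarith

end Coefficients

/-! ### Pointwise estimates -/

section Estimates

variable {M D₂ D₃ h p q s t : ℝ}

lemma sq_le_two_mul_sq (hpq : |p| * h + |q| * h ^ 2 ≤ 1 / 2) (hs : |s| ≤ h)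
    (hst : cubicPrim p q s = t) : |s| ≤ 2 * |t| ∧ s ^ 2 ≤ 2 * t ^ 2 := by
  have h1 := le_abs_cubicPrim hpq hs
  rw [hst] at h1
  refine ⟨by linarith [abs_nonneg s, abs_nonneg t], ?_⟩
  rw [← sq_abs s, ← sq_abs t]
  nlinarith [abs_nonneg s, abs_nonneg t]

lemma abs_sub_le_of_cubicPrim_eq (hM : 0 < M) (hD₂ : 0 ≤ D₂) (hD₂h : D₂ * h ≤ 1)
    (hp : |p| ≤ 12 * M ^ 2 * D₂) (hq : |q| ≤ 6 * M * D₂ ^ 2)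
    (hpq : |p| * h + |q| * h ^ 2 ≤ 1 / 2) (hs : |s| ≤ h) (hst : cubicPrim p q s = t) :
    |s - t| ≤ 12 * (M ^ 2 + M) * D₂ * t ^ 2 := by
  have h1 := abs_cubicPrim_sub_le p q s
  rw [hst, abs_sub_comm] at h1
  have h2 := (sq_le_two_mul_sq hpq hs hst).2
  calc |s - t| ≤ s ^ 2 * (|p| / 2 + |q| * |s| / 3) := h1
    _ ≤ (2 * t ^ 2) * (12 * M ^ 2 * D₂ / 2 + 6 * M * D₂ ^ 2 * h / 3) := by gcongr
    _ = (2 * t ^ 2) * (6 * M ^ 2 * D₂ + 2 * M * D₂ * (D₂ * h)) := by ring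
    _ ≤ (2 * t ^ 2) * (6 * M ^ 2 * D₂ + 2 * M * D₂ * 1) := by gcongr
    _ ≤ 12 * (M ^ 2 + M) * D₂ * t ^ 2 := by
      have : 0 ≤ M * D₂ * t ^ 2 := by positivity
      linarith

lemma half_le_one_add (hpq : |p| * h + |q| * h ^ 2 ≤ 1 / 2) (hs : |s| ≤ h) :
    1 / 2 ≤ 1 + p * s + q * s ^ 2 := by
  have := abs_le.1 ((abs_mul_add_mul_sq_le (a := p) (b := q) hs).trans hpq)
  linarith

lemma abs_sub_one_le_of_mul_eq_one (hM : 0 < M) (hD₂ : 0 ≤ D₂) (hD₂h : D₂ * h ≤ 1)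
    (hp : |p| ≤ 12 * M ^ 2 * D₂) (hq : |q| ≤ 6 * M * D₂ ^ 2)
    (hpq : |p| * h + |q| * h ^ 2 ≤ 1 / 2) (hs : |s| ≤ h) (hst : cubicPrim p q s = t)
    {L : ℝ} (hL : L * (1 + p * s + q * s ^ 2) = 1) :
    |L - 1| ≤ 48 * (M ^ 2 + M) * D₂ * |t| := by
  have hP := half_le_one_add hpq hs
  have h1 : |p * s + q * s ^ 2| ≤ |s| * (|p| + |q| * |s|) := by
    refine (abs_add_le _ _).trans (le_of_eq ?_)
    rw [abs_mul, abs_mul, abs_pow]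
    ring
  have h2 := (sq_le_two_mul_sq hpq hs hst).1
  have h3 : |L - 1| * (1 / 2) ≤ |p * s + q * s ^ 2| := by
    have : (L - 1) * (1 + p * s + q * s ^ 2) = -(p * s + q * s ^ 2) := by
      linear_combination hL
    rw [← abs_neg (p * s + q * s ^ 2), ← this, abs_mul]
    gcongr
    exact hP.trans (le_abs_self _)
  have h4 : |s| * (|p| + |q| * |s|) ≤ (2 * |t|) * (12 * M ^ 2 * D₂ + 6 * M * D₂ * 1) :=
    calc |s| * (|p| + |q| * |s|)
        ≤ (2 * |t|) * (12 * M ^ 2 * D₂ + 6 * M * D₂ ^ 2 * h) := by gcongr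
      _ = (2 * |t|) * (12 * M ^ 2 * D₂ + 6 * M * D₂ * (D₂ * h)) := by ring
      _ ≤ _ := by gcongr
  have : 0 ≤ M * D₂ * |t| := by positivity
  linarith

lemma abs_le_of_mul_add_eq_zero (hM : 0 < M) (hD₂ : 0 ≤ D₂) (hD₃ : 0 ≤ D₃)
    (hD₂h : D₂ * h ≤ 1) (hD : D₂ ^ 2 ≤ M * D₃)
    (hpq : |p| * h + |q| * h ^ 2 ≤ 1 / 2) (hs : |s| ≤ h) (hst : cubicPrim p q s = t)
    {L p' q' : ℝ} (hp' : |p'| ≤ 12 * M ^ 2 * D₃ + 24 * M * D₂ ^ 2)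
    (hq' : |q'| ≤ 12 * M * D₂ * D₃ + 6 * D₂ ^ 3)
    (hL : L * (1 + p * s + q * s ^ 2) + (p' * s ^ 2 / 2 + q' * s ^ 3 / 3) = 0) :
    |L| ≤ 72 * (M ^ 2 + M) * D₃ * t ^ 2 := by
  have hP := half_le_one_add hpq hs
  have hp'' : |p'| ≤ 36 * M ^ 2 * D₃ := by
    have : M * D₂ ^ 2 ≤ M * (M * D₃) := by gcongr
    linarith
  have hq'' : |q'| ≤ 18 * M * D₂ * D₃ := by
    have : D₂ * D₂ ^ 2 ≤ D₂ * (M * D₃) := by gcongr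
    linarith
  have h1 : |L| * (1 / 2) ≤ s ^ 2 * (|p'| / 2 + |q'| * |s| / 3) := by
    calc |L| * (1 / 2) ≤ |L| * |1 + p * s + q * s ^ 2| := by
          gcongr
          exact hP.trans (le_abs_self _)
      _ = |s ^ 2 * (p' / 2 + q' * s / 3)| := by
          rw [← abs_mul, ← abs_neg]
          congr 1
          linear_combination -hL
      _ ≤ _ := by
          rw [abs_mul, abs_of_nonneg (sq_nonneg s)]
          gcongr
          refine (abs_add_le _ _).trans ?_
          simp [abs_mul, abs_div]
  have h2 := (sq_le_two_mul_sq hpq hs hst).2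
  have h3 : s ^ 2 * (|p'| / 2 + |q'| * |s| / 3)
      ≤ (2 * t ^ 2) * (18 * M ^ 2 * D₃ + 6 * M * D₃ * 1) :=
    calc s ^ 2 * (|p'| / 2 + |q'| * |s| / 3)
        ≤ (2 * t ^ 2) * (36 * M ^ 2 * D₃ / 2 + 18 * M * D₂ * D₃ * h / 3) := by gcongr
      _ = (2 * t ^ 2) * (18 * M ^ 2 * D₃ + 6 * M * D₃ * (D₂ * h)) := by ring
      _ ≤ _ := by gcongr
  have : 0 ≤ M * D₃ * t ^ 2 := by positivity
  linarith

end Estimates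

/-- The incompressible extension, with estimates in terms of bounds `M`, `D₂`, `D₃` on the first,
second and third order quantities. -/
theorem exists_unique_incompressible_extension {ω U : Set (Fin 2 → ℝ)} (hω : IsOpen ω)
    (hU : IsOpen U) (hωU : closure ω ⊆ U) {y b : (Fin 2 → ℝ) → Fin 3 → ℝ}
    (hy : ContDiffOn ℝ 2 y U) (hb : ContDiffOn ℝ 2 b U)
    (hdet : ∀ x ∈ ω, (aug (jac32 y x) (b x)).det = 1) {M D₂ D₃ h : ℝ} (hM : 0 < M)
    (hh : 0 < h) (hD₂ : 0 ≤ D₂) (hD₃ : 0 ≤ D₃)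
    (hsmall : 12 * M ^ 2 * (D₂ * h) + 6 * M * (D₂ * h) ^ 2 ≤ 1 / 2)
    (hD₂h : D₂ * h ≤ 1) (hD : D₂ ^ 2 ≤ M * D₃)
    (h₁ : ∀ x ∈ ω, ‖fderiv ℝ y x‖ + ‖b x‖ ≤ M)
    (h₂ : ∀ x ∈ ω, ‖iteratedFDeriv ℝ 2 y x‖ + ‖fderiv ℝ b x‖ ≤ D₂)
    (h₃ : ∀ x ∈ ω, ‖iteratedFDeriv ℝ 2 b x‖ ≤ D₃) :
    ∃ ξ : (Fin 3 → ℝ) → ℝ,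
      (ContDiffOn ℝ 1 ξ (closure (slab ω h)) ∧ (∀ xt ∈ closure ω, ξ (emb xt 0) = 0) ∧
        ∀ x ∈ slab ω h, (jac3 (fun z => y (proj2 z) + ξ z • b (proj2 z)) x).det = 1) ∧
      (∀ ξ' : (Fin 3 → ℝ) → ℝ,
        (ContDiffOn ℝ 1 ξ' (closure (slab ω h)) ∧ (∀ xt ∈ closure ω, ξ' (emb xt 0) = 0) ∧
          ∀ x ∈ slab ω h, (jac3 (fun z => y (proj2 z) + ξ' z • b (proj2 z)) x).det = 1) →
        EqOn ξ' ξ (closure (slab ω h))) ∧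
      ∀ x ∈ slab ω h,
        |ξ x - x 2| ≤ 12 * (M ^ 2 + M) * D₂ * x 2 ^ 2 ∧
        |fderiv ℝ ξ x (Pi.single 2 1) - 1| ≤ 48 * (M ^ 2 + M) * D₂ * |x 2| ∧
        Real.sqrt (fderiv ℝ ξ x (Pi.single 0 1) ^ 2 + fderiv ℝ ξ x (Pi.single 1 1) ^ 2)
          ≤ 144 * (M ^ 2 + M) * D₃ * x 2 ^ 2 := by
  have hy₁ : ∀ x ∈ ω, ‖fderiv ℝ y x‖ ≤ M := fun x hx => by
    linarith [h₁ x hx, norm_nonneg (b x)]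
  have hb₀ : ∀ x ∈ ω, ‖b x‖ ≤ M := fun x hx => by
    linarith [h₁ x hx, norm_nonneg (fderiv ℝ y x)]
  have hy₂ : ∀ x ∈ ω, ‖iteratedFDeriv ℝ 2 y x‖ ≤ D₂ := fun x hx => by
    linarith [h₂ x hx, norm_nonneg (fderiv ℝ b x)]
  have hb₁ : ∀ x ∈ ω, ‖fderiv ℝ b x‖ ≤ D₂ := fun x hx => by
    linarith [h₂ x hx, norm_nonneg (iteratedFDeriv ℝ 2 y x)]
  have hωU' : ω ⊆ U := subset_closure.trans hωU
  have hpC := contDiffOn_linCoeff hU hy hb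
  have hqC := contDiffOn_quadCoeff hU hb
  set p := linCoeff y b
  set q := quadCoeff b
  have hp : ∀ x ∈ ω, |p x| ≤ 12 * M ^ 2 * D₂ := fun x hx =>
    abs_linCoeff_le (hy₁ x hx) (hb₀ x hx) (hb₁ x hx)
  have hq : ∀ x ∈ ω, |q x| ≤ 6 * M * D₂ ^ 2 := fun x hx =>
    abs_quadCoeff_le (hb₀ x hx) (hb₁ x hx)
  have hpq : ∀ x ∈ closure ω, |p x| * h + |q x| * h ^ 2 ≤ 1 / 2 := by
    refine le_on_closure (fun x hx => ?_) ?_ continuousOn_const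
    · calc |p x| * h + |q x| * h ^ 2
          ≤ 12 * M ^ 2 * D₂ * h + 6 * M * D₂ ^ 2 * h ^ 2 := by
            gcongr
            exacts [hp x hx, hq x hx]
        _ ≤ 1 / 2 := by linarith
    · have hpc := hpC.continuousOn.mono hωU
      have hqc := hqC.continuousOn.mono hωU
      fun_prop
  have hpqω : ∀ x ∈ ω, |p x| * h + |q x| * h ^ 2 ≤ 1 / 2 := fun x hx =>
    hpq x (subset_closure hx)
  have hdiff {f : (Fin 3 → ℝ) → ℝ} (hf : ContDiffOn ℝ 1 f (closure (slab ω h))) :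
      DifferentiableOn ℝ f (slab ω h) := (hf.differentiableOn one_ne_zero).mono subset_closure
  have hnhds {z : Fin 3 → ℝ} (hz : z ∈ slab ω h) : slab ω h ∈ 𝓝 z :=
    (isOpen_slab hω h).mem_nhds hz
  have hUn {z : Fin 3 → ℝ} (hz : z ∈ slab ω h) : U ∈ 𝓝 (proj2 z) :=
    hU.mem_nhds (hωU' hz.1)
  have hdj {f : (Fin 3 → ℝ) → ℝ} (hf : ContDiffOn ℝ 1 f (closure (slab ω h)))
      {z : Fin 3 → ℝ} (hz : z ∈ slab ω h) :
      (jac3 (fun z => y (proj2 z) + f z • b (proj2 z)) z).det =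
        fderiv ℝ f z (Pi.single 2 1) * (1 + p (proj2 z) * f z + q (proj2 z) * f z ^ 2) :=
    det_jac3_eq ((hy.contDiffAt (hUn hz)).differentiableAt two_ne_zero)
      ((hb.contDiffAt (hUn hz)).differentiableAt two_ne_zero)
      ((hdiff hf).differentiableAt (hnhds hz)) (hdet _ hz.1)
  obtain ⟨ξ, hξ⟩ := exists_cubicPrim_eq_on_slab hpq
  have hξcl : ∀ z ∈ closure (slab ω h), |ξ z| ≤ h ∧
      cubicPrim (p (proj2 z)) (q (proj2 z)) (ξ z) = z 2 := fun z hz =>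
    hξ z (closure_slab_subset ω h hz).1 (closure_slab_subset ω h hz).2
  have hξsl : ∀ z ∈ slab ω h, |ξ z| ≤ h ∧
      cubicPrim (p (proj2 z)) (q (proj2 z)) (ξ z) = z 2 := fun z hz =>
    hξcl z (subset_closure hz)
  have hξC := contDiffOn_of_cubicPrim_eq hU hωU hpC hqC hh hpq hξcl
  have hder {z : Fin 3 → ℝ} (hz : z ∈ slab ω h) (v : Fin 3 → ℝ) :=
    fderiv_of_cubicPrim_eq hω (fun z hz => (hξsl z hz).2) hz
      ((hdiff hξC).differentiableAt (hnhds hz))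
      ((hpC.contDiffAt (hUn hz)).differentiableAt one_ne_zero)
      ((hqC.contDiffAt (hUn hz)).differentiableAt one_ne_zero) v
  have hder2 {z : Fin 3 → ℝ} (hz : z ∈ slab ω h) : fderiv ℝ ξ z (Pi.single 2 1) *
      (1 + p (proj2 z) * ξ z + q (proj2 z) * ξ z ^ 2) = 1 := by
    simpa [proj2_single_two] using hder hz (Pi.single 2 1)
  refine ⟨ξ, ⟨hξC, fun x hx => ?_, fun z hz => by rw [hdj hξC hz, hder2 hz]⟩, ?_, ?_⟩
  · obtain ⟨h4, h5⟩ := hξ (emb x 0) (by simpa using hx) (by simpa using by positivity)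
    rw [proj2_emb, emb_two] at h5
    refine cubicPrim_injOn (hpq x hx) h4 (by simpa using hh.le) (h5.trans ?_)
    simp [cubicPrim]
  · rintro f ⟨hfC, hf0, hfdet⟩
    refine EqOn.of_subset_closure (fun z hz => ?_) hfC.continuousOn hξC.continuousOn
      subset_closure subset_rfl
    obtain ⟨h4, h5⟩ := cubicPrim_eq_of_fderiv hω hh hpqω (hdiff hfC)
      (fun x hx => hf0 x (subset_closure hx))
      (fun z hz => by rw [← hdj hfC hz, hfdet z hz]) hz
    exact cubicPrim_injOn (hpqω _ hz.1) h4 (hξsl z hz).1 (h5.trans (hξsl z hz).2.symm)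
  · intro z hz
    obtain ⟨hs, hst⟩ := hξsl z hz
    have hx := hz.1
    have hpqz := hpqω _ hx
    have hgrad (i : Fin 3) (j : Fin 2) (hij : proj2 (Pi.single i 1) = Pi.single j 1)
        (hi : (Pi.single i 1 : Fin 3 → ℝ) 2 = 0) :
        |fderiv ℝ ξ z (Pi.single i 1)| ≤ 72 * (M ^ 2 + M) * D₃ * z 2 ^ 2 := by
      have h4 := hder hz (Pi.single i 1)
      rw [hij, hi] at h4
      exact abs_le_of_mul_add_eq_zero hM hD₂ hD₃ hD₂h hD hpqz hs hst
        (abs_fderiv_linCoeff_le hU hy hb (hωU' hx) (hy₁ _ hx) (hy₂ _ hx) (hb₀ _ hx) (hb₁ _ hx)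
          (h₃ _ hx) j)
        (abs_fderiv_quadCoeff_le hU hb (hωU' hx) (hb₀ _ hx) (hb₁ _ hx) (h₃ _ hx) j) h4
    refine ⟨abs_sub_le_of_cubicPrim_eq hM hD₂ hD₂h (hp _ hx) (hq _ hx) hpqz hs hst,
      abs_sub_one_le_of_mul_eq_one hM hD₂ hD₂h (hp _ hx) (hq _ hx) hpqz hs hst (hder2 hz), ?_⟩
    have h4 := hgrad 0 0 proj2_single_zero (by simp)
    have h5 := hgrad 1 1 proj2_single_one (by simp)
    refine Real.sqrt_le_iff.2 ⟨by positivity, ?_⟩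
    rw [← sq_abs, ← sq_abs (fderiv ℝ ξ z (Pi.single 1 1))]
    nlinarith [abs_nonneg (fderiv ℝ ξ z (Pi.single 0 1)),
      abs_nonneg (fderiv ℝ ξ z (Pi.single 1 1))]

/-- incompressible extensions: given families `y^δ, b^δ` satisfying the
`α`-dependent bounds with constant `M`, there exist `m ≥ 1` and `C > 0` (depending only
on `M` and `α`) such that, setting `δ_h = m h`, for all small `h > 0` there is a
function `ξ^h`, `C¹` on `closure Ω_h`, vanishing at `x₃ = 0`, making
`Y^h = y^{δ_h} + ξ^h b^{δ_h}` incompressible on `Ω_h`; `ξ^h` is unique on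
`closure Ω_h` and satisfies the stated pointwise estimates. -/
theorem statement18 (α : ℤ) (hα : α = -1 ∨ α = 0 ∨ α = 1) (M : ℝ) (hM : 0 < M) :
    ∃ mm : ℝ, 1 ≤ mm ∧ ∃ C : ℝ, 0 < C ∧
      ∀ (ω : Set (Fin 2 → ℝ)), IsOpen ω → Bornology.IsBounded ω →
      ∀ δ₀ : ℝ, 0 < δ₀ →
      ∀ Y B : ℝ → (Fin 2 → ℝ) → Fin 3 → ℝ,
        (∀ δ : ℝ, 0 < δ → δ < δ₀ →
          (∃ U, IsOpen U ∧ closure ω ⊆ U ∧ ContDiffOn ℝ 3 (Y δ) U) ∧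
          (∃ U, IsOpen U ∧ closure ω ⊆ U ∧ ContDiffOn ℝ 2 (B δ) U)) →
        (∀ δ : ℝ, 0 < δ → δ < δ₀ → ∀ x ∈ ω, (aug (jac32 (Y δ) x) (B δ x)).det = 1) →
        (∀ δ : ℝ, 0 < δ → δ < δ₀ → ∀ x ∈ ω, ‖fderiv ℝ (Y δ) x‖ + ‖B δ x‖ ≤ M) →
        (∀ δ : ℝ, 0 < δ → δ < δ₀ → ∀ x ∈ ω,
          ‖iteratedFDeriv ℝ 2 (Y δ) x‖ + ‖fderiv ℝ (B δ) x‖ ≤ M * δ ^ (min (-α) 0)) →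
        (∀ δ : ℝ, 0 < δ → δ < δ₀ → ∀ x ∈ ω,
          ‖iteratedFDeriv ℝ 3 (Y δ) x‖ + ‖iteratedFDeriv ℝ 2 (B δ) x‖ ≤ M * δ ^ (-α - 1)) →
        ∃ h₀ : ℝ, 0 < h₀ ∧ ∀ h : ℝ, 0 < h → h < h₀ →
          ∃ ξ : (Fin 3 → ℝ) → ℝ,
            (ContDiffOn ℝ 1 ξ (closure (slab ω h)) ∧
              (∀ xt ∈ closure ω, ξ (emb xt 0) = 0) ∧
              (∀ x ∈ slab ω h,
                (jac3 (fun z => Y (mm * h) (proj2 z) + ξ z • B (mm * h) (proj2 z)) x).det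
                  = 1)) ∧
            (∀ ξ' : (Fin 3 → ℝ) → ℝ,
              (ContDiffOn ℝ 1 ξ' (closure (slab ω h)) ∧
                (∀ xt ∈ closure ω, ξ' (emb xt 0) = 0) ∧
                (∀ x ∈ slab ω h,
                  (jac3 (fun z => Y (mm * h) (proj2 z) + ξ' z • B (mm * h) (proj2 z)) x).det
                    = 1)) →
              Set.EqOn ξ' ξ (closure (slab ω h))) ∧
            (∀ x ∈ slab ω h,
              |ξ x - x 2| ≤ C * h ^ (min (-α) 0) * (x 2) ^ 2 ∧
              |fderiv ℝ ξ x (Pi.single 2 1) - 1| ≤ C * h ^ (min (-α) 0) * |x 2| ∧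
              Real.sqrt ((fderiv ℝ ξ x (Pi.single 0 1)) ^ 2
                  + (fderiv ℝ ξ x (Pi.single 1 1)) ^ 2)
                ≤ C * h ^ (-α - 1) * (x 2) ^ 2) := by
  have hmm : 0 < 1 + 36 * M * (M + 1) ^ 2 := by positivity
  refine ⟨1 + 36 * M * (M + 1) ^ 2, le_add_of_nonneg_right (by positivity),
    144 * (M ^ 2 + M) * M, by positivity, ?_⟩
  set m := 1 + 36 * M * (M + 1) ^ 2 with hm
  have hm1 : 1 ≤ m := le_add_of_nonneg_right (by positivity)
  intro ω hω _ δ₀ hδ₀ Y B hreg hdet h₁ h₂ h₃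
  refine ⟨min 1 δ₀ / m, by positivity, fun h hh hlt => ?_⟩
  rw [lt_div_iff₀' hmm, lt_min_iff] at hlt
  obtain ⟨hδ1, hδlt⟩ := hlt
  have hδ : 0 < m * h := by positivity
  have hhδ : h ≤ m * h := le_mul_of_one_le_left hh.le hm1
  set δ := m * h with hδdef
  obtain ⟨⟨U₁, hU₁, hωU₁, hY⟩, ⟨U₂, hU₂, hωU₂, hB⟩⟩ := hreg δ hδ hδlt
  have hscale : δ ^ min (-α) 0 * h * m ≤ 1 ∧ (δ ^ min (-α) 0) ^ 2 ≤ δ ^ (-α - 1) ∧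
      δ ^ min (-α) 0 ≤ h ^ min (-α) 0 ∧ δ ^ (-α - 1) ≤ h ^ (-α - 1) := by
    have hinv : δ⁻¹ ≤ h⁻¹ := inv_anti₀ hh hhδ
    have hone : 1 ≤ δ⁻¹ := (one_le_inv₀ hδ).2 hδ1.le
    rcases hα with rfl | rfl | rfl
    · norm_num
      linarith
    · norm_num
      exact ⟨by linarith, hone, hinv⟩
    · have e1 : min (-1 : ℤ) 0 = -1 := rfl
      have e2 : (-1 - 1 : ℤ) = -2 := rfl
      have e3 (r : ℝ) : r ^ (-2 : ℤ) = r⁻¹ ^ 2 := by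
        rw [_root_.zpow_neg, inv_pow]; rfl
      simp only [e1, e2, e3, _root_.zpow_neg_one]
      refine ⟨?_, le_rfl, hinv, by gcongr⟩
      rw [mul_assoc, mul_comm h m, ← hδdef, inv_mul_cancel₀ hδ.ne']
  obtain ⟨hk, hk2, hkh, hlh⟩ := hscale
  have hk0 : 0 < δ ^ min (-α) 0 := zpow_pos hδ _
  have hl0 : 0 < δ ^ (-α - 1) := zpow_pos hδ _
  set r := M * δ ^ min (-α) 0 * h with hr
  have hr0 : 0 ≤ r := by positivity
  have hrm : r * (36 * (M + 1) ^ 2) ≤ 1 := by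
    refine le_trans ?_ hk
    rw [hr, hm]
    have : 0 ≤ δ ^ min (-α) 0 * h := by positivity
    linarith
  have hr1 : r ≤ 1 := by nlinarith
  have hsmall : 12 * M ^ 2 * r + 6 * M * r ^ 2 ≤ 1 / 2 := by
    have h5 : M * r * r ≤ M * r * 1 := by gcongr
    have h6 : 0 ≤ M * r := by positivity
    nlinarith
  obtain ⟨ξ, hξ, huniq, hest⟩ := exists_unique_incompressible_extension (D₂ := M * δ ^ min (-α) 0)
    (D₃ := M * δ ^ (-α - 1)) hω (hU₁.inter hU₂) (subset_inter hωU₁ hωU₂)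
    ((hY.of_le (by norm_num)).mono inter_subset_left) (hB.mono inter_subset_right)
    (hdet δ hδ hδlt) hM hh (by positivity) (by positivity) hsmall hr1
    (by rw [mul_pow, sq M, mul_assoc]; gcongr)
    (h₁ δ hδ hδlt) (h₂ δ hδ hδlt)
    (fun x hx => (le_add_of_nonneg_left (norm_nonneg _)).trans (h₃ δ hδ hδlt x hx))
  refine ⟨ξ, hξ, huniq, fun x hx => ?_⟩
  obtain ⟨h4, h5, h6⟩ := hest x hx
  refine ⟨h4.trans ?_, h5.trans ?_, h6.trans ?_⟩
  · calc 12 * (M ^ 2 + M) * (M * δ ^ min (-α) 0) * x 2 ^ 2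
        = 12 * (M ^ 2 + M) * M * δ ^ min (-α) 0 * x 2 ^ 2 := by ring
      _ ≤ 144 * (M ^ 2 + M) * M * h ^ min (-α) 0 * x 2 ^ 2 := by gcongr; norm_num
  · calc 48 * (M ^ 2 + M) * (M * δ ^ min (-α) 0) * |x 2|
        = 48 * (M ^ 2 + M) * M * δ ^ min (-α) 0 * |x 2| := by ring
      _ ≤ 144 * (M ^ 2 + M) * M * h ^ min (-α) 0 * |x 2| := by gcongr; norm_num
  · calc 144 * (M ^ 2 + M) * (M * δ ^ (-α - 1)) * x 2 ^ 2
        = 144 * (M ^ 2 + M) * M * δ ^ (-α - 1) * x 2 ^ 2 := by ring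
      _ ≤ 144 * (M ^ 2 + M) * M * h ^ (-α - 1) * x 2 ^ 2 := by gcongr
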